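/- Let q>1 be a real number and d∈(−π,π). Then for every integer n≥0 the integral ∫_0^∞ (r e^{id})^n · Θ_q(q r e^{id})^{−1} · e^{id} dr converges absolutely and q^{n(n−1)/2} = (q / log q) · ∫_0^∞ (r e^{id})^n · Θ_q(q r e^{id})^{−1} · e^{id} dr. -/

import Mathlib

set_option autoImplicit false

open Complex Real MeasureTheory

/-- The Jacobi Theta function `Θ_q(z) = ∑_{n ∈ ℤ} q^{-n(n-1)/2} z^n`. -/
noncomputable def jacobiThetaQ (q : ℝ) (z : ℂ) : ℂ :=
  ∑' n : ℤ, z ^ n / (q : ℂ) ^ ((n * (n - 1)) / 2)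

/-- The general term of the series defining `jacobiThetaQ`. -/
noncomputable def thetaTerm (q : ℝ) (z : ℂ) (n : ℤ) : ℂ :=
  z ^ n / (q : ℂ) ^ ((n * (n - 1)) / 2)

lemma triangle_add (a b : ℤ) :
    (a + b) * (a + b - 1) / 2 = a * (a - 1) / 2 + b * (b - 1) / 2 + a * b := by
  obtain ⟨x, hx⟩ := Int.even_mul_pred_self a
  obtain ⟨y, hy⟩ := Int.even_mul_pred_self b
  have h : (a + b) * (a + b - 1) = 2 * (x + y + a * b) := by linear_combination hx + hy
  rw [h, hx, hy]
  omega

lemma thetaTerm_ne_zero {q : ℝ} (hq : q ≠ 0) {z : ℂ} (hz : z ≠ 0) (n : ℤ) :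
    thetaTerm q z n ≠ 0 :=
  div_ne_zero (zpow_ne_zero _ hz) (zpow_ne_zero _ (by exact_mod_cast hq))

lemma thetaTerm_add {q : ℝ} (hq : q ≠ 0) {z : ℂ} (hz : z ≠ 0) (m n : ℤ) :
    thetaTerm q z (m + n) = thetaTerm q z m * thetaTerm q z n / (q : ℂ) ^ (m * n) := by
  have hq' : (q : ℂ) ≠ 0 := by exact_mod_cast hq
  simp only [thetaTerm, triangle_add, zpow_add₀ hz, zpow_add₀ hq']
  field_simp

lemma thetaTerm_one (q : ℝ) (z : ℂ) : thetaTerm q z 1 = z := by simp [thetaTerm]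

lemma thetaTerm_neg_one (q : ℝ) (z : ℂ) : thetaTerm q z (-1) = z⁻¹ / q := by
  simp [thetaTerm]

lemma thetaTerm_add_one {q : ℝ} (hq : q ≠ 0) {z : ℂ} (hz : z ≠ 0) (n : ℤ) :
    thetaTerm q z (n + 1) = thetaTerm q z n * z / (q : ℂ) ^ n := by
  rw [thetaTerm_add hq hz, thetaTerm_one, mul_one]

lemma thetaTerm_sub_one {q : ℝ} (hq : q ≠ 0) {z : ℂ} (hz : z ≠ 0) (n : ℤ) :
    thetaTerm q z (n - 1) = thetaTerm q z n * (q : ℂ) ^ (n - 1) / z := by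
  have hq' : (q : ℂ) ≠ 0 := by exact_mod_cast hq
  rw [sub_eq_add_neg, thetaTerm_add hq hz, thetaTerm_neg_one, zpow_add₀ hq', mul_neg_one,
    zpow_neg]
  simp only [zpow_neg, zpow_one]
  field_simp

lemma summable_norm_of_ratio_tendsto_zero {f : ℕ → ℂ} (hf : ∀ n, f n ≠ 0)
    (h : Filter.Tendsto (fun n => ‖f (n + 1)‖ / ‖f n‖) Filter.atTop (nhds 0)) :
    Summable fun n => ‖f n‖ :=
  summable_of_ratio_test_tendsto_lt_one zero_lt_one
    (Filter.Eventually.of_forall fun n => by simpa using hf n) (by simpa using h)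

lemma tendsto_const_mul_inv_pow {q : ℝ} (hq : 1 < q) (c : ℝ) :
    Filter.Tendsto (fun n : ℕ => c * (q⁻¹) ^ n) Filter.atTop (nhds 0) := by
  simpa using (tendsto_pow_atTop_nhds_zero_of_lt_one (by positivity)
    (inv_lt_one_of_one_lt₀ hq)).const_mul c

lemma summable_norm_thetaTerm {q : ℝ} (hq : 1 < q) {z : ℂ} (hz : z ≠ 0) :
    Summable fun n : ℤ => ‖thetaTerm q z n‖ := by
  have hq0 : q ≠ 0 := by positivity
  have hqp : 0 < q := by positivity
  refine Summable.of_nat_of_neg ?_ ?_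
  · refine summable_norm_of_ratio_tendsto_zero (f := fun n : ℕ => thetaTerm q z n)
      (fun n => thetaTerm_ne_zero hq0 hz _) ?_
    refine (tendsto_const_mul_inv_pow hq ‖z‖).congr fun n => ?_
    have h : ‖thetaTerm q z n‖ ≠ 0 := norm_ne_zero_iff.2 (thetaTerm_ne_zero hq0 hz _)
    push_cast
    rw [thetaTerm_add_one hq0 hz, norm_div, norm_mul, zpow_natCast, norm_pow, norm_real,
      Real.norm_of_nonneg hqp.le, inv_pow]
    field_simp
  · refine summable_norm_of_ratio_tendsto_zero (f := fun n : ℕ => thetaTerm q z (-n))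
      (fun n => thetaTerm_ne_zero hq0 hz _) ?_
    refine (tendsto_const_mul_inv_pow hq (q⁻¹ / ‖z‖)).congr fun n => ?_
    have h : ‖thetaTerm q z (-n)‖ ≠ 0 := norm_ne_zero_iff.2 (thetaTerm_ne_zero hq0 hz _)
    have e : (-((n + 1 : ℕ) : ℤ)) = -(n : ℤ) - 1 := by push_cast; ring
    have e' : (-(n : ℤ) - 1) = -((n + 1 : ℕ) : ℤ) := by push_cast; ring
    rw [e, thetaTerm_sub_one hq0 hz, norm_div, norm_mul, e', zpow_neg, zpow_natCast, norm_inv,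
      norm_pow, norm_real, Real.norm_of_nonneg hqp.le, inv_pow, pow_succ]
    have hz' : ‖z‖ ≠ 0 := norm_ne_zero_iff.2 hz
    field_simp

lemma thetaTerm_zpow_mul {q : ℝ} (hq : q ≠ 0) {z : ℂ} (hz : z ≠ 0) (k m : ℤ) :
    thetaTerm q ((q : ℂ) ^ k * z) m =
      thetaTerm q z (m - k) * (z ^ k * (q : ℂ) ^ (k * (k + 1) / 2)) := by
  have hq' : (q : ℂ) ≠ 0 := by exact_mod_cast hq
  have h : k * k = k * (k - 1) / 2 + k * (k + 1) / 2 := by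
    obtain ⟨x, hx⟩ := Int.even_mul_pred_self k
    have h₁ : k * (k + 1) = 2 * (x + k) := by linear_combination hx
    have h₂ : k * k = 2 * x + k := by linear_combination hx
    rw [h₁, h₂, hx]
    omega
  obtain ⟨l, rfl⟩ : ∃ l, m = l + k := ⟨m - k, by ring⟩
  have h₁ : thetaTerm q ((q : ℂ) ^ k * z) (l + k) =
      (q : ℂ) ^ (k * (l + k)) * thetaTerm q z (l + k) := by
    simp only [thetaTerm, mul_zpow, ← zpow_mul, mul_div_assoc]
  rw [h₁, add_sub_cancel_right, thetaTerm_add hq hz, mul_add, zpow_add₀ hq', h,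
    zpow_add₀ hq', mul_comm k l]
  simp only [thetaTerm]
  field_simp

lemma jacobiThetaQ_zpow_mul {q : ℝ} (hq : q ≠ 0) {z : ℂ} (hz : z ≠ 0) (k : ℤ) :
    jacobiThetaQ q ((q : ℂ) ^ k * z) =
      jacobiThetaQ q z * (z ^ k * (q : ℂ) ^ (k * (k + 1) / 2)) := by
  change ∑' m, thetaTerm q _ m = (∑' m, thetaTerm q z m) * _
  simp_rw [thetaTerm_zpow_mul hq hz k]
  rw [tsum_mul_right]
  congr 1
  exact (Equiv.subRight k).tsum_eq (thetaTerm q z)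

lemma jacobiThetaQ_mul {q : ℝ} (hq : q ≠ 0) {z : ℂ} (hz : z ≠ 0) :
    jacobiThetaQ q (q * z) = jacobiThetaQ q z * (z * q) := by
  simpa using jacobiThetaQ_zpow_mul hq hz 1

lemma norm_thetaTerm_le {q a b : ℝ} (ha : 0 < a) {z : ℂ} (haz : a ≤ ‖z‖)
    (hzb : ‖z‖ ≤ b) (n : ℤ) :
    ‖thetaTerm q z n‖ ≤ ‖thetaTerm q a n‖ + ‖thetaTerm q b n‖ := by
  have hz : 0 < ‖z‖ := ha.trans_le haz
  have hb : 0 < b := hz.trans_le hzb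
  simp only [thetaTerm, norm_div, norm_zpow, norm_real, Real.norm_of_nonneg ha.le,
    Real.norm_of_nonneg hb.le]
  rw [← add_div]
  gcongr
  rcases le_total 0 n with hn | hn
  · exact (zpow_le_zpow_left₀ hn hz.le hzb).trans (le_add_of_nonneg_left (by positivity))
  · obtain ⟨m, rfl⟩ : ∃ m : ℕ, n = -m := ⟨n.natAbs, by omega⟩
    have : ‖z‖ ^ (-m : ℤ) ≤ a ^ (-m : ℤ) := by
      simp only [zpow_neg, zpow_natCast]
      gcongr
    exact this.trans (le_add_of_nonneg_right (by positivity))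

lemma continuousAt_jacobiThetaQ {q : ℝ} (hq : 1 < q) {z : ℂ} (hz : z ≠ 0) :
    ContinuousAt (jacobiThetaQ q) z := by
  have hz' : 0 < ‖z‖ := norm_pos_iff.2 hz
  let s : Set ℂ := {w | ‖z‖ / 2 ≤ ‖w‖ ∧ ‖w‖ ≤ 2 * ‖z‖}
  have hs : s ∈ nhds z := by
    filter_upwards [continuous_norm.continuousAt.eventually_mem (Icc_mem_nhds (a := ‖z‖ / 2)
      (b := 2 * ‖z‖) (x := ‖z‖) (by linarith) (by linarith))] with w hw using hw
  refine ContinuousOn.continuousAt (s := s) ?_ hs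
  refine continuousOn_tsum (f := fun n w => thetaTerm q w n)
    (u := fun n => ‖thetaTerm q (‖z‖ / 2 : ℝ) n‖ + ‖thetaTerm q (2 * ‖z‖ : ℝ) n‖) ?_ ?_ ?_
  · intro n w hw
    have : w ≠ 0 := norm_pos_iff.1 ((half_pos hz').trans_le hw.1)
    exact ((continuousAt_zpow₀ w n (Or.inl this)).div_const _).continuousWithinAt
  · refine (summable_norm_thetaTerm hq ?_).add (summable_norm_thetaTerm hq ?_)
    · exact_mod_cast (half_pos hz').ne'
    · exact_mod_cast (by positivity : (2 * ‖z‖) ≠ 0)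
  · intro n w hw
    exact norm_thetaTerm_le (half_pos hz') hw.1 hw.2 n

/-- The finite `p`-Pochhammer product `∏_{i < m} (1 - p ^ (i + 1))`. -/
noncomputable def qFactorial (p : ℂ) (m : ℕ) : ℂ := ∏ i ∈ Finset.range m, (1 - p ^ (i + 1))

/-- The Gaussian binomial coefficient, as a quotient of Pochhammer products. -/
noncomputable def gaussBinom (p : ℂ) (m k : ℕ) : ℂ :=
  if k ≤ m then qFactorial p m / (qFactorial p k * qFactorial p (m - k)) else 0

lemma qFactorial_succ (p : ℂ) (m : ℕ) :
    qFactorial p (m + 1) = qFactorial p m * (1 - p ^ (m + 1)) :=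
  Finset.prod_range_succ _ _

lemma one_sub_pow_ne_zero {p : ℂ} (hp : ‖p‖ < 1) (i : ℕ) : 1 - p ^ (i + 1) ≠ 0 := by
  intro h
  have h₁ : ‖p‖ ^ (i + 1) = 1 := by rw [← norm_pow, ← sub_eq_zero.1 h, norm_one]
  exact (pow_lt_one₀ (norm_nonneg _) hp (Nat.succ_ne_zero i)).ne h₁

lemma qFactorial_ne_zero {p : ℂ} (hp : ‖p‖ < 1) (m : ℕ) : qFactorial p m ≠ 0 :=
  Finset.prod_ne_zero_iff.2 fun i _ => one_sub_pow_ne_zero hp i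

lemma gaussBinom_zero_right {p : ℂ} (hp : ‖p‖ < 1) (m : ℕ) : gaussBinom p m 0 = 1 := by
  have h : qFactorial p 0 = 1 := Finset.prod_range_zero _
  simp [gaussBinom, h, div_self (qFactorial_ne_zero hp m)]

lemma gaussBinom_succ_succ {p : ℂ} (hp : ‖p‖ < 1) {m k : ℕ} (hk : k ≤ m) :
    gaussBinom p (m + 1) (k + 1) = gaussBinom p m (k + 1) + p ^ (m - k) * gaussBinom p m k := by
  obtain ⟨j, rfl⟩ := Nat.exists_eq_add_of_le hk
  have hA := qFactorial_ne_zero hp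
  have hB := one_sub_pow_ne_zero hp
  rcases j with _ | j
  · simp [gaussBinom, div_self (hA _), qFactorial.eq_1 p 0]
  · have e₁ : k + (j + 1) + 1 - (k + 1) = j + 1 := by omega
    have e₂ : k + (j + 1) - (k + 1) = j := by omega
    have e₃ : k + (j + 1) - k = j + 1 := by omega
    have := hA k
    have := hA j
    have := hB k
    have := hB j
    rw [gaussBinom, gaussBinom, gaussBinom, if_pos (by omega), if_pos (by omega),
      if_pos (by omega), e₁, e₂, e₃, qFactorial_succ p (k + (j + 1)), qFactorial_succ p k,
      qFactorial_succ p j]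
    field_simp
    ring

lemma prod_one_add_pow_mul {p : ℂ} (hp : ‖p‖ < 1) (w : ℂ) (m : ℕ) :
    ∏ i ∈ Finset.range m, (1 + p ^ i * w) =
      ∑ k ∈ Finset.range (m + 1), gaussBinom p m k * (p ^ (k.choose 2) * w ^ k) := by
  induction m with
  | zero => simp [gaussBinom_zero_right hp]
  | succ m ih =>
    have h₁ : ∑ k ∈ Finset.range (m + 1), gaussBinom p m k * (p ^ (k.choose 2) * w ^ k) =
        ∑ k ∈ Finset.range (m + 2), gaussBinom p m k * (p ^ (k.choose 2) * w ^ k) := by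
      rw [Finset.sum_range_succ _ (m + 1)]
      simp [gaussBinom]
    rw [Finset.prod_range_succ, ih, mul_add, mul_one]
    nth_rewrite 1 [h₁]
    rw [Finset.sum_range_succ', Finset.sum_range_succ' _ (m + 1), gaussBinom_zero_right hp,
      gaussBinom_zero_right hp, add_right_comm, Finset.sum_mul, ← Finset.sum_add_distrib]
    congr 1
    refine Finset.sum_congr rfl fun k hk => ?_
    have hkm : k ≤ m := by simpa [Nat.lt_succ_iff] using hk
    rw [gaussBinom_succ_succ hp hkm, Nat.choose_succ_succ' k 1, Nat.choose_one_right,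
      ← Nat.sub_add_cancel hkm]
    simp only [Nat.add_sub_cancel, pow_add]
    ring

lemma tendsto_qFactorial {p : ℂ} (hp : ‖p‖ < 1) :
    ∃ a : ℂ, a ≠ 0 ∧ Filter.Tendsto (qFactorial p) Filter.atTop (nhds a) := by
  have hs : Summable fun i : ℕ => ‖-p ^ (i + 1)‖ := by
    simp only [norm_neg, norm_pow]
    exact (summable_nat_add_iff 1).2 (summable_geometric_of_lt_one (norm_nonneg _) hp)
  refine ⟨∏' i : ℕ, (1 + -p ^ (i + 1)), tprod_one_add_ne_zero_of_summable (fun i => ?_) hs, ?_⟩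
  · simpa [sub_eq_add_neg] using one_sub_pow_ne_zero hp i
  · simpa only [qFactorial.eq_1, funext (qFactorial.eq_1 p), sub_eq_add_neg] using
      (multipliable_one_add_of_summable hs).tendsto_prod_tprod_nat

lemma exists_norm_gaussBinom_le {p : ℂ} (hp : ‖p‖ < 1) :
    ∃ C : ℝ, ∀ m k, ‖gaussBinom p m k‖ ≤ C := by
  obtain ⟨a, ha, h⟩ := tendsto_qFactorial hp
  obtain ⟨B, hB⟩ := (Metric.isBounded_range_of_tendsto _ h).exists_norm_le
  obtain ⟨D, hD⟩ := (Metric.isBounded_range_of_tendsto _ (h.inv₀ ha)).exists_norm_le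
  simp only [Set.mem_range, forall_exists_index, forall_apply_eq_imp_iff] at hB hD
  have hB0 : 0 ≤ B := (norm_nonneg _).trans (hB 0)
  have hD0 : 0 ≤ D := (norm_nonneg _).trans (hD 0)
  refine ⟨B * (D * D), fun m k => ?_⟩
  unfold gaussBinom
  split_ifs
  · rw [div_eq_mul_inv, mul_inv, norm_mul, norm_mul]
    gcongr
    exacts [hB _, hD _, hD _]
  · simp only [norm_zero]
    positivity

lemma thetaTerm_natCast {q : ℝ} (hq : q ≠ 0) {z : ℂ} (hz : z ≠ 0) (k : ℕ) :
    thetaTerm q z k = (q : ℂ)⁻¹ ^ (k.choose 2) * z ^ k := by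
  induction k with
  | zero => simp [thetaTerm]
  | succ k ih =>
    push_cast
    rw [thetaTerm_add_one hq hz, ih, Nat.choose_succ_succ' k 1, Nat.choose_one_right,
      zpow_natCast]
    simp only [inv_pow, pow_add, pow_one]
    have hq' : (q : ℂ) ≠ 0 := by exact_mod_cast hq
    field_simp

lemma thetaTerm_natCast_sub {q : ℝ} (hq : q ≠ 0) {z : ℂ} (hz : z ≠ 0) (k N : ℕ) :
    thetaTerm q z (k - N) =
      (q : ℂ)⁻¹ ^ (k.choose 2) * ((q : ℂ) ^ N * z) ^ k * thetaTerm q z (-N) := by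
  have hq' : (q : ℂ) ≠ 0 := by exact_mod_cast hq
  rw [sub_eq_add_neg, thetaTerm_add hq hz, thetaTerm_natCast hq hz, mul_neg, zpow_neg,
    mul_pow, ← pow_mul, mul_comm (k : ℤ), ← Nat.cast_mul, zpow_natCast, div_inv_eq_mul]
  ring

lemma thetaTerm_neg_mul_prod {q : ℝ} (hq : q ≠ 0) {z : ℂ} (hz : z ≠ 0) (N : ℕ) :
    thetaTerm q z (-N) * ∏ j ∈ Finset.range N, (1 + (q : ℂ) ^ (j + 1) * z) =
      ∏ j ∈ Finset.range N, (1 + (q : ℂ)⁻¹ ^ (j + 1) * z⁻¹) := by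
  have hq' : (q : ℂ) ≠ 0 := by exact_mod_cast hq
  induction N with
  | zero => simp [thetaTerm]
  | succ N ih =>
    have e : -((N + 1 : ℕ) : ℤ) = -(N : ℤ) - 1 := by push_cast; ring
    have e' : -(N : ℤ) - 1 = -((N + 1 : ℕ) : ℤ) := by push_cast; ring
    rw [Finset.prod_range_succ, Finset.prod_range_succ, ← ih, e, thetaTerm_sub_one hq hz, e',
      zpow_neg, zpow_natCast, inv_pow]
    field_simp
    ring

lemma norm_inv_lt_one {q : ℝ} (hq : 1 < q) : ‖(q : ℂ)⁻¹‖ < 1 := by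
  rw [norm_inv, norm_real, Real.norm_of_nonneg (by positivity)]
  exact inv_lt_one_of_one_lt₀ hq

/-- The finite form of the Jacobi triple product identity. -/
lemma finite_triple_product {q : ℝ} (hq : 1 < q) {z : ℂ} (hz : z ≠ 0) (N : ℕ) :
    (∏ j ∈ Finset.range N, (1 + (q : ℂ)⁻¹ ^ j * z)) *
        ∏ j ∈ Finset.range N, (1 + (q : ℂ)⁻¹ ^ (j + 1) * z⁻¹) =
      ∑ k ∈ Finset.range (2 * N + 1),
        gaussBinom (q : ℂ)⁻¹ (2 * N) k * thetaTerm q z (k - N) := by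
  have hq0 : q ≠ 0 := by positivity
  have hq' : (q : ℂ) ≠ 0 := by exact_mod_cast hq0
  have hp := norm_inv_lt_one hq
  simp_rw [thetaTerm_natCast_sub hq0 hz, ← mul_assoc]
  rw [← Finset.sum_mul]
  simp_rw [mul_assoc]
  rw [← prod_one_add_pow_mul hp, two_mul, Finset.prod_range_add, ← thetaTerm_neg_mul_prod hq0 hz]
  have h₁ : ∀ j ∈ Finset.range N, 1 + (q : ℂ)⁻¹ ^ (N - 1 - j) * ((q : ℂ) ^ N * z) =
      1 + (q : ℂ) ^ (j + 1) * z := by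
    intro j hj
    have e : N = (N - 1 - j) + (j + 1) := by have := Finset.mem_range.1 hj; omega
    rw [← mul_assoc]
    nth_rewrite 2 [e]
    rw [pow_add, ← mul_assoc, ← mul_pow, inv_mul_cancel₀ hq', one_pow, one_mul]
  have h₂ : ∀ j ∈ Finset.range N, 1 + (q : ℂ)⁻¹ ^ (N + j) * ((q : ℂ) ^ N * z) =
      1 + (q : ℂ)⁻¹ ^ j * z := by
    intro j _
    rw [pow_add, inv_pow _ N]
    field_simp
  rw [← Finset.prod_range_reflect (fun j => 1 + (q : ℂ)⁻¹ ^ j * ((q : ℂ) ^ N * z)),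
    Finset.prod_congr rfl h₁, Finset.prod_congr rfl h₂]
  ring

lemma sum_gaussBinom_eq_tsum (p : ℂ) (t : ℤ → ℂ) (N : ℕ) :
    ∑ k ∈ Finset.range (2 * N + 1), gaussBinom p (2 * N) k * t (k - N) =
      ∑' n : ℤ, if -(N : ℤ) ≤ n then gaussBinom p (2 * N) (n + N).toNat * t n else 0 := by
  have hinj : Function.Injective fun k : ℕ => (k : ℤ) - N := fun a b h => by
    simp only at h
    omega
  rw [← hinj.tsum_eq, tsum_eq_sum (s := Finset.range (2 * N + 1))]
  · refine Finset.sum_congr rfl fun k _ => ?_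
    rw [if_pos (by omega)]
    simp
  · intro k hk
    have hk' : ¬ k ≤ 2 * N := by simpa [Nat.lt_succ_iff] using hk
    rw [if_pos (by omega)]
    simp [gaussBinom, hk']
  · intro n hn
    by_cases h : -(N : ℤ) ≤ n
    · exact ⟨(n + N).toNat, by simp only; omega⟩
    · simp [h] at hn

lemma exists_tendsto_triple_product {q : ℝ} (hq : 1 < q) {z : ℂ} (hz : z ≠ 0) :
    ∃ c : ℂ, Filter.Tendsto (fun N : ℕ =>
      (∏ j ∈ Finset.range N, (1 + (q : ℂ)⁻¹ ^ j * z)) *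
        ∏ j ∈ Finset.range N, (1 + (q : ℂ)⁻¹ ^ (j + 1) * z⁻¹)) Filter.atTop
      (nhds (c * jacobiThetaQ q z)) := by
  have hp := norm_inv_lt_one hq
  obtain ⟨a, ha, hlim⟩ := tendsto_qFactorial hp
  obtain ⟨C, hC⟩ := exists_norm_gaussBinom_le hp
  refine ⟨a / (a * a), ?_⟩
  simp_rw [finite_triple_product hq hz, sum_gaussBinom_eq_tsum]
  change Filter.Tendsto _ _ (nhds (_ * ∑' n, thetaTerm q z n))
  rw [← tsum_mul_left]
  refine tendsto_tsum_of_dominated_convergence (bound := fun n => C * ‖thetaTerm q z n‖)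
    ((summable_norm_thetaTerm hq hz).mul_left C) (fun n => ?_)
    (Filter.Eventually.of_forall fun N n => ?_)
  · have h₁ : Filter.Tendsto (fun N : ℕ => 2 * N) Filter.atTop Filter.atTop :=
      Filter.tendsto_atTop_mono (fun N => by simp only [id]; omega) Filter.tendsto_id
    have h₂ : Filter.Tendsto (fun N : ℕ => (n + N).toNat) Filter.atTop Filter.atTop :=
      Filter.tendsto_atTop.2 fun b => by
        filter_upwards [Filter.eventually_ge_atTop (b + n.natAbs)] with N hN
        omega
    have h₃ : Filter.Tendsto (fun N : ℕ => 2 * N - (n + N).toNat) Filter.atTop Filter.atTop :=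
      Filter.tendsto_atTop.2 fun b => by
        filter_upwards [Filter.eventually_ge_atTop (b + n.natAbs)] with N hN
        omega
    refine (((hlim.comp h₁).div ((hlim.comp h₂).mul (hlim.comp h₃))
      (mul_ne_zero ha ha)).mul_const (thetaTerm q z n)).congr' ?_
    filter_upwards [Filter.eventually_ge_atTop n.natAbs] with N hN
    rw [if_pos (by omega), gaussBinom, if_pos (by omega)]
    rfl
  · split_ifs
    · rw [norm_mul]
      gcongr
      exact hC _ _
    · rw [norm_zero]
      exact mul_nonneg ((norm_nonneg _).trans (hC 0 0)) (norm_nonneg _)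

lemma one_add_mul_ne_zero {z : ℂ} (hz : z ∈ slitPlane) {c : ℝ} (hc : 0 ≤ c) :
    1 + (c : ℂ) * z ≠ 0 := by
  intro h
  have hre := congrArg Complex.re h
  have him := congrArg Complex.im h
  simp only [add_re, one_re, re_ofReal_mul, zero_re, add_im, one_im, im_ofReal_mul,
    zero_im, zero_add] at hre him
  rcases mul_eq_zero.1 him with h0 | h0
  · simp [h0] at hre
  · rcases hz with h1 | h1
    · nlinarith
    · exact h1 h0

/-- The function `Θ_q` does not vanish away from the negative real axis. -/
lemma jacobiThetaQ_ne_zero {q : ℝ} (hq : 1 < q) {z : ℂ} (hz : z ∈ slitPlane) :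
    jacobiThetaQ q z ≠ 0 := by
  have hp := norm_inv_lt_one hq
  obtain ⟨c, hc⟩ := exists_tendsto_triple_product hq (slitPlane_ne_zero hz)
  have hgeom := summable_geometric_of_lt_one (norm_nonneg _) hp
  have hs₁ : Summable fun j : ℕ => ‖(q : ℂ)⁻¹ ^ j * z‖ := by
    simpa only [norm_mul, norm_pow] using hgeom.mul_right ‖z‖
  have hs₂ : Summable fun j : ℕ => ‖(q : ℂ)⁻¹ ^ (j + 1) * z⁻¹‖ := by
    simpa only [norm_mul, norm_pow] using
      ((summable_nat_add_iff 1).2 hgeom).mul_right ‖z⁻¹‖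
  have hlim := (multipliable_one_add_of_summable hs₁).tendsto_prod_tprod_nat.mul
    (multipliable_one_add_of_summable hs₂).tendsto_prod_tprod_nat
  have hne : ∀ (w : ℂ), w ∈ slitPlane → ∀ j : ℕ, 1 + (q : ℂ)⁻¹ ^ j * w ≠ 0 := fun w hw j => by
    simpa using one_add_mul_ne_zero hw (c := q⁻¹ ^ j) (by positivity)
  have hz' : z⁻¹ ∈ slitPlane := by
    rw [mem_slitPlane_iff_arg, arg_inv]
    have harg := mem_slitPlane_iff_arg.1 hz
    refine ⟨?_, inv_ne_zero harg.2⟩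
    rw [if_neg harg.1]
    intro h
    linarith [neg_pi_lt_arg z]
  intro h0
  have h := tendsto_nhds_unique hlim hc
  rw [h0, mul_zero] at h
  exact mul_ne_zero (tprod_one_add_ne_zero_of_summable (hne z hz) hs₁)
    (tprod_one_add_ne_zero_of_summable (fun j => hne z⁻¹ hz' (j + 1)) hs₂) h

/-- The ray of direction `d`, parametrised by `s ↦ q ^ s * e ^ (i d)`. -/
noncomputable def qRay (q d s : ℝ) : ℂ :=
  (Real.exp (Real.log q * s) : ℂ) * Complex.exp (Complex.I * d)

lemma norm_qRay (q d s : ℝ) : ‖qRay q d s‖ = Real.exp (Real.log q * s) := by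
  rw [qRay, norm_mul, norm_real, Real.norm_of_nonneg (Real.exp_pos _).le, mul_comm Complex.I,
    norm_exp_ofReal_mul_I, mul_one]

lemma qRay_mem_slitPlane (q : ℝ) {d : ℝ} (hd1 : -π < d) (hd2 : d < π) (s : ℝ) :
    qRay q d s ∈ slitPlane := by
  rw [mem_slitPlane_iff_arg, qRay, mul_comm Complex.I, exp_mul_I,
    arg_mul_cos_add_sin_mul_I (Real.exp_pos _) ⟨hd1, hd2.le⟩]
  refine ⟨hd2.ne, norm_pos_iff.1 ?_⟩
  rw [← exp_mul_I, mul_comm _ Complex.I, ← qRay, norm_qRay]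
  exact Real.exp_pos _

lemma qRay_add_intCast {q : ℝ} (hq : 0 < q) (d s : ℝ) (k : ℤ) :
    qRay q d (s + k) = (q : ℂ) ^ k * qRay q d s := by
  have h : Real.exp (Real.log q * (s + k)) = q ^ k * Real.exp (Real.log q * s) := by
    rw [mul_add, Real.exp_add, mul_comm, ← Real.rpow_intCast, Real.rpow_def_of_pos hq]
  rw [qRay, qRay, h]
  push_cast
  ring

lemma continuous_qRay (q d : ℝ) : Continuous (qRay q d) := by
  unfold qRay
  fun_prop

/-- A single theta term divided by the theta function, along a ray. -/
noncomputable def thetaQuotient (q d : ℝ) (n : ℤ) (s : ℝ) : ℂ :=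
  thetaTerm q (qRay q d s) n / jacobiThetaQ q (qRay q d s)

lemma thetaQuotient_add_intCast {q d : ℝ} (hq : 1 < q) (hd1 : -π < d) (hd2 : d < π)
    (n : ℤ) (s : ℝ) (k : ℤ) :
    thetaQuotient q d n (s + k) =
      thetaTerm q (qRay q d s) (n - k) / jacobiThetaQ q (qRay q d s) := by
  have hz := slitPlane_ne_zero (qRay_mem_slitPlane q hd1 hd2 s)
  have hq0 : q ≠ 0 := by positivity
  have hq' : (q : ℂ) ≠ 0 := by exact_mod_cast hq0
  rw [thetaQuotient, qRay_add_intCast (by positivity), thetaTerm_zpow_mul hq0 hz,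
    jacobiThetaQ_zpow_mul hq0 hz, mul_div_mul_right]
  exact mul_ne_zero (zpow_ne_zero _ hz) (zpow_ne_zero _ hq')

lemma hasSum_thetaQuotient {q d : ℝ} (hq : 1 < q) (hd1 : -π < d) (hd2 : d < π)
    (n : ℤ) (s : ℝ) :
    HasSum (fun k : ℤ => thetaQuotient q d n (s + k)) 1 := by
  have hz := qRay_mem_slitPlane q hd1 hd2 s
  simp_rw [thetaQuotient_add_intCast hq hd1 hd2]
  have h : HasSum (thetaTerm q (qRay q d s)) (jacobiThetaQ q (qRay q d s)) :=
    (summable_norm_thetaTerm hq (slitPlane_ne_zero hz)).of_norm.hasSum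
  have h' := ((Equiv.subLeft n).hasSum_iff.2 h).div_const (jacobiThetaQ q (qRay q d s))
  rwa [div_self (jacobiThetaQ_ne_zero hq hz)] at h'

lemma continuous_jacobiThetaQ_qRay {q d : ℝ} (hq : 1 < q) (hd1 : -π < d) (hd2 : d < π) :
    Continuous fun s => jacobiThetaQ q (qRay q d s) :=
  continuous_iff_continuousAt.2 fun s =>
    (continuousAt_jacobiThetaQ hq (slitPlane_ne_zero (qRay_mem_slitPlane q hd1 hd2 s))).comp
      (continuous_qRay q d).continuousAt

lemma continuous_thetaQuotient {q d : ℝ} (hq : 1 < q) (hd1 : -π < d) (hd2 : d < π)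
    (n : ℤ) : Continuous (thetaQuotient q d n) := by
  refine Continuous.div ?_ (continuous_jacobiThetaQ_qRay hq hd1 hd2)
    fun s => jacobiThetaQ_ne_zero hq (qRay_mem_slitPlane q hd1 hd2 s)
  exact ((continuous_qRay q d).zpow₀ n fun s =>
    Or.inl (slitPlane_ne_zero (qRay_mem_slitPlane q hd1 hd2 s))).div_const _

lemma exists_summable_thetaQuotient_bound {q d : ℝ} (hq : 1 < q) (hd1 : -π < d) (hd2 : d < π)
    (n : ℤ) :
    ∃ u : ℤ → ℝ, Summable u ∧
      ∀ (k : ℤ), ∀ s ∈ Set.Icc (0 : ℝ) 1, ‖thetaQuotient q d n (s + k)‖ ≤ u k := by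
  have hcont : Continuous fun s => (jacobiThetaQ q (qRay q d s))⁻¹ :=
    (continuous_jacobiThetaQ_qRay hq hd1 hd2).inv₀
      fun s => jacobiThetaQ_ne_zero hq (qRay_mem_slitPlane q hd1 hd2 s)
  obtain ⟨C, hC⟩ := (isCompact_Icc (a := (0 : ℝ)) (b := 1)).exists_bound_of_continuousOn
    hcont.continuousOn
  have hq' : (q : ℂ) ≠ 0 := by exact_mod_cast (by positivity : q ≠ 0)
  have hsum := (summable_norm_thetaTerm hq (z := ((1 : ℝ) : ℂ)) (by simp)).add
    (summable_norm_thetaTerm hq hq')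
  refine ⟨fun k => (‖thetaTerm q (1 : ℝ) (n - k)‖ + ‖thetaTerm q q (n - k)‖) * C,
    ((Equiv.subLeft n).summable_iff.2 hsum).mul_right C, fun k s hs => ?_⟩
  have hlog : 0 ≤ Real.log q := Real.log_nonneg hq.le
  rw [thetaQuotient_add_intCast hq hd1 hd2, div_eq_mul_inv, norm_mul]
  refine mul_le_mul (norm_thetaTerm_le zero_lt_one ?_ ?_ _) (hC s hs) (norm_nonneg _)
    (by positivity)
  · rw [norm_qRay]
    exact Real.one_le_exp (mul_nonneg hlog hs.1)
  · rw [norm_qRay]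
    calc Real.exp (Real.log q * s) ≤ Real.exp (Real.log q) :=
          Real.exp_le_exp.2 (mul_le_of_le_one_right hlog hs.2)
      _ = q := Real.exp_log (by positivity)

lemma integrable_thetaQuotient {q d : ℝ} (hq : 1 < q) (hd1 : -π < d) (hd2 : d < π)
    (n : ℤ) : Integrable (thetaQuotient q d n) := by
  obtain ⟨u, hu, hb⟩ := exists_summable_thetaQuotient_bound hq hd1 hd2 n
  have hcont := continuous_thetaQuotient hq hd1 hd2 n
  rw [← integrableOn_univ, ← iUnion_Icc_intCast ℝ]
  refine integrableOn_iUnion_of_summable_integral_norm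
    (fun k => hcont.continuousOn.integrableOn_compact isCompact_Icc)
    (.of_nonneg_of_le (fun k => integral_nonneg fun s => norm_nonneg _) (fun k => ?_) hu)
  have h := norm_setIntegral_le_of_norm_le_const (μ := volume) (s := Set.Icc (k : ℝ) (k + 1))
    (f := fun s => ‖thetaQuotient q d n s‖) (C := u k) isCompact_Icc.measure_lt_top
    fun s hs => by
      have := hb k (s - k) ⟨by linarith [hs.1], by linarith [hs.2]⟩
      simpa using this
  exact (le_abs_self _).trans (by simpa [Measure.real] using h)

lemma integral_thetaQuotient {q d : ℝ} (hq : 1 < q) (hd1 : -π < d) (hd2 : d < π)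
    (n : ℤ) : ∫ s, thetaQuotient q d n s = 1 := by
  obtain ⟨u, hu, hb⟩ := exists_summable_thetaQuotient_bound hq hd1 hd2 n
  have hcont := continuous_thetaQuotient hq hd1 hd2 n
  have h₁ := (integrable_thetaQuotient hq hd1 hd2 n).hasSum_intervalIntegral_comp_add_int
  have h₂ : HasSum (fun k : ℤ => ∫ s in (0 : ℝ)..1, thetaQuotient q d n (s + k))
      (∫ _ in (0 : ℝ)..1, (1 : ℂ)) := by
    refine intervalIntegral.hasSum_integral_of_dominated_convergence (fun k _ => u k)
      (fun k => (by fun_prop : Continuous fun s : ℝ =>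
        thetaQuotient q d n (s + k)).aestronglyMeasurable)
      (fun k => .of_forall fun s hs => ?_) (.of_forall fun _ _ => hu)
      intervalIntegrable_const (.of_forall fun s _ => hasSum_thetaQuotient hq hd1 hd2 n s)
    rw [Set.uIoc_of_le zero_le_one] at hs
    exact hb k s ⟨hs.1.le, hs.2⟩
  simpa using h₁.unique h₂

lemma range_exp_log_mul {q : ℝ} (hq : 1 < q) :
    (fun s => Real.exp (Real.log q * s)) '' Set.univ = Set.Ioi 0 := by
  have hlog : Real.log q ≠ 0 := (Real.log_pos hq).ne'
  ext r
  simp only [Set.image_univ, Set.mem_range, Set.mem_Ioi]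
  refine ⟨?_, fun hr => ⟨Real.log r / Real.log q, ?_⟩⟩
  · rintro ⟨s, rfl⟩
    exact Real.exp_pos _
  · rw [mul_div_cancel₀ _ hlog, Real.exp_log hr]

theorem theta_moment_representation (q : ℝ) (hq : 1 < q) (d : ℝ)
    (hd1 : -π < d) (hd2 : d < π) (n : ℕ) :
    IntegrableOn (fun r : ℝ =>
        ((r : ℂ) * Complex.exp (Complex.I * d)) ^ n /
          jacobiThetaQ q (q * (r * Complex.exp (Complex.I * d))) *
          Complex.exp (Complex.I * d)) (Set.Ioi 0) ∧
    ((q : ℂ)) ^ (n * (n - 1) / 2) = ((q : ℂ) / Real.log q) *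
      ∫ r in Set.Ioi (0 : ℝ),
        ((r : ℂ) * Complex.exp (Complex.I * d)) ^ n /
          jacobiThetaQ q (q * (r * Complex.exp (Complex.I * d))) *
          Complex.exp (Complex.I * d) := by
  set g : ℝ → ℂ := fun r => ((r : ℂ) * Complex.exp (Complex.I * d)) ^ n /
    jacobiThetaQ q (q * (r * Complex.exp (Complex.I * d))) * Complex.exp (Complex.I * d) with hg
  have hq0 : q ≠ 0 := by positivity
  have hq' : (q : ℂ) ≠ 0 := by exact_mod_cast hq0
  have hlog : 0 < Real.log q := Real.log_pos hq
  have hlog' : (Real.log q : ℂ) ≠ 0 := by exact_mod_cast hlog.ne'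
  have hderiv : ∀ s ∈ Set.univ, HasDerivWithinAt (fun s => Real.exp (Real.log q * s))
      (Real.exp (Real.log q * s) * Real.log q) Set.univ s := fun s _ => by
    simpa using ((hasDerivAt_id s).const_mul (Real.log q)).exp
  have hinj : Set.InjOn (fun s => Real.exp (Real.log q * s)) Set.univ := fun s _ t _ h =>
    mul_left_cancel₀ hlog.ne' (Real.exp_injective h)
  have hkey : ∀ s, |Real.exp (Real.log q * s) * Real.log q| • g (Real.exp (Real.log q * s)) =
      (Real.log q / q * (q : ℂ) ^ (n * (n - 1) / 2)) * thetaQuotient q d n s := by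
    intro s
    have hmem := qRay_mem_slitPlane q hd1 hd2 s
    have hz := slitPlane_ne_zero hmem
    have hθ := jacobiThetaQ_ne_zero hq hmem
    rw [abs_of_pos (by positivity), Complex.real_smul]
    simp only [hg]
    rw [← qRay, jacobiThetaQ_mul hq0 hz, thetaQuotient, thetaTerm_natCast hq0 hz,
      Nat.choose_two_right, inv_pow]
    have hE := Complex.exp_ne_zero (Complex.I * d)
    have he : (Real.exp (Real.log q * s) : ℂ) * Complex.exp (Complex.I * d) = qRay q d s := rfl
    push_cast at he ⊢
    field_simp
    linear_combination he
  have hint := integrable_thetaQuotient hq hd1 hd2 n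
  rw [← range_exp_log_mul hq]
  constructor
  · rw [integrableOn_image_iff_integrableOn_abs_deriv_smul MeasurableSet.univ hderiv hinj]
    simp_rw [hkey]
    exact (hint.const_mul _).integrableOn
  · rw [integral_image_eq_integral_abs_deriv_smul MeasurableSet.univ hderiv hinj,
      funext hkey, setIntegral_univ, integral_const_mul, integral_thetaQuotient hq hd1 hd2]
    field_simp
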